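/- Let H be a real separable Hilbert space and A, B self-adjoint positive trace-class operators on H. Then ‖A^{1/2} − B^{1/2}‖²_{HS} ≤ ‖A − B‖_tr, where A^{1/2}, B^{1/2} denote the positive square roots. -/

import Mathlib

/- STATEMENT 17: For positive self-adjoint trace-class operators `A, B` on a real separable
Hilbert space `H`, `‖A^{1/2} − B^{1/2}‖²_{HS} ≤ ‖A − B‖_tr`.

Encoding: `e` is a Hilbert basis of `H` (countable index, i.e. `H` separable); the
Hilbert–Schmidt norm squared of `C` is `∑' k, ‖C (e k)‖²`; the trace norm of the self-adjoint
operator `A - B` is `∑' k, ⟪e k, S (e k)⟫` where `S` is the (unique) positive square root of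
`(A - B)* ∘ (A - B)`, i.e. `S = |A - B|`; the positive square roots `A^{1/2}, B^{1/2}` are the
(unique) positive operators `SA, SB` with `SA ∘ SA = A`, `SB ∘ SB = B`; trace-class-ness of a
positive operator `A` is summability of `k ↦ ⟪e k, A (e k)⟫`. -/

open scoped RealInnerProductSpace

noncomputable section

namespace HilbertBasis

variable {H : Type*} [NormedAddCommGroup H] [InnerProductSpace ℝ H] {ι κ : Type*}

/-- Parseval's identity. -/
theorem hasSum_inner_sq (e : HilbertBasis ι ℝ H) (y : H) :
    HasSum (fun k => ⟪e k, y⟫ ^ 2) (‖y‖ ^ 2) := by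
  have h := e.hasSum_inner_mul_inner y y
  rw [real_inner_self_eq_norm_sq] at h
  refine h.congr_fun fun k => ?_
  rw [real_inner_comm y, sq]

/-- Parseval's identity in `ℝ≥0∞`. -/
theorem ofReal_norm_sq_eq_tsum (e : HilbertBasis ι ℝ H) (y : H) :
    ENNReal.ofReal (‖y‖ ^ 2) = ∑' k, ENNReal.ofReal (⟪e k, y⟫ ^ 2) := by
  have h := e.hasSum_inner_sq y
  rw [← h.tsum_eq, ENNReal.ofReal_tsum_of_nonneg (fun _ => sq_nonneg _) h.summable]

/-- The Hilbert–Schmidt norm of a symmetric operator does not depend on the Hilbert basis. -/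
theorem tsum_norm_sq_apply_eq (e : HilbertBasis ι ℝ H) (f : HilbertBasis κ ℝ H)
    {C : H →L[ℝ] H} (hC : C.IsSymmetric) :
    ∑' k, ENNReal.ofReal (‖C (e k)‖ ^ 2) = ∑' j, ENNReal.ofReal (‖C (f j)‖ ^ 2) := by
  simp_rw [f.ofReal_norm_sq_eq_tsum (C (e _)), e.ofReal_norm_sq_eq_tsum (C (f _))]
  rw [ENNReal.tsum_comm]
  refine tsum_congr fun j => tsum_congr fun k => ?_
  rw [← hC.apply_clm, real_inner_comm]

/-- The quadratic form of a symmetric operator that is diagonal in a Hilbert basis. -/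
theorem hasSum_inner_apply_of_eigen (g : HilbertBasis κ ℝ H) {C : H →L[ℝ] H}
    (hC : C.IsSymmetric) {c : κ → ℝ} (hg : ∀ j, C (g j) = c j • g j) (x : H) :
    HasSum (fun j => c j * ⟪g j, x⟫ ^ 2) ⟪x, C x⟫ := by
  refine (g.hasSum_inner_mul_inner x (C x)).congr_fun fun j => ?_
  rw [← hC.apply_clm, hg, real_inner_smul_left, real_inner_comm x]
  ring

/-- The trace of a positive diagonal operator is the sum of its eigenvalues. -/
theorem tsum_inner_apply_eq_of_eigen (e : HilbertBasis ι ℝ H) (g : HilbertBasis κ ℝ H)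
    {C : H →L[ℝ] H} (hC : C.IsSymmetric) {c : κ → ℝ} (hc : ∀ j, 0 ≤ c j)
    (hg : ∀ j, C (g j) = c j • g j) :
    ∑' k, ENNReal.ofReal ⟪e k, C (e k)⟫ = ∑' j, ENNReal.ofReal (c j) := by
  have h (x : H) : ENNReal.ofReal ⟪x, C x⟫
      = ∑' j, ENNReal.ofReal (c j) * ENNReal.ofReal (⟪x, g j⟫ ^ 2) := by
    have h := g.hasSum_inner_apply_of_eigen hC hg x
    rw [← h.tsum_eq, ENNReal.ofReal_tsum_of_nonneg
      (fun j => mul_nonneg (hc j) (sq_nonneg _)) h.summable]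
    refine tsum_congr fun j => ?_
    rw [ENNReal.ofReal_mul (hc j), real_inner_comm]
  simp_rw [h]
  rw [ENNReal.tsum_comm]
  refine tsum_congr fun j => ?_
  rw [ENNReal.tsum_mul_left, ← e.ofReal_norm_sq_eq_tsum, g.orthonormal.1]
  simp

/-- A symmetric Hilbert–Schmidt operator is compact. -/
theorem isCompactOperator_of_summable_norm_sq [CompleteSpace H] (e : HilbertBasis ι ℝ H)
    {C : H →L[ℝ] H} (hC : C.IsSymmetric) (hs : Summable fun k => ‖C (e k)‖ ^ 2) :
    IsCompactOperator C := by
  classical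
  let F (s : Finset ι) : H →L[ℝ] H := ∑ k ∈ s, (innerSL ℝ (C (e k))).smulRight (e k)
  have hF (s : Finset ι) (x : H) : F s x = ∑ k ∈ s, ⟪C (e k), x⟫ • e k := by
    simp [F]
  have hcoef (s : Finset ι) (x : H) (k : ι) :
      ⟪e k, C x - F s x⟫ = if k ∈ s then 0 else ⟪C (e k), x⟫ := by
    rw [inner_sub_right, hF, inner_sum, ← hC.apply_clm]
    simp only [inner_smul_right, orthonormal_iff_ite.1 e.orthonormal, mul_ite, mul_one, mul_zero,
      Finset.sum_ite_eq]
    split_ifs <;> simp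
  have hbound (s : Finset ι) :
      ‖C - F s‖ ≤ √(∑' k : {k // k ∉ s}, ‖C (e k)‖ ^ 2) := by
    refine ContinuousLinearMap.opNorm_le_bound _ (Real.sqrt_nonneg _) fun x => ?_
    refine le_of_sq_le_sq ?_ (by positivity)
    rw [mul_pow, Real.sq_sqrt (tsum_nonneg fun _ => sq_nonneg _)]
    have htail : HasSum (Set.indicator {k | k ∉ s} fun k => ‖C (e k)‖ ^ 2)
        (∑' k : {k // k ∉ s}, ‖C (e k)‖ ^ 2) :=
      hasSum_subtype_iff_indicator.1 (hs.subtype {k | k ∉ s}).hasSum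
    refine hasSum_le (fun k => ?_) (e.hasSum_inner_sq _) (htail.mul_right (‖x‖ ^ 2))
    rw [sub_apply, hcoef]
    by_cases hk : k ∈ s
    · simp [hk]
    · have h : |⟪C (e k), x⟫| ≤ ‖C (e k)‖ * ‖x‖ := abs_real_inner_le_norm _ _
      simpa [hk, mul_pow] using pow_le_pow_left₀ (abs_nonneg _) h 2
  refine isCompactOperator_of_tendsto (F := F) (l := Filter.atTop) ?_ (.of_forall fun s => ?_)
  · rw [tendsto_iff_norm_sub_tendsto_zero]
    refine squeeze_zero (fun _ => norm_nonneg _) (fun s => (norm_sub_rev _ _).trans_le (hbound s)) ?_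
    simpa using (tendsto_tsum_compl_atTop_zero fun k => ‖C (e k)‖ ^ 2).sqrt
  · refine Submodule.sum_mem (compactOperator (RingHom.id ℝ) H H) fun k _ => ?_
    exact (isCompactOperator_of_locallyCompactSpace_rng
      (ContinuousLinearMap.toSpanSingleton ℝ (e k))).comp_clm (innerSL ℝ (C (e k)))

end HilbertBasis

section

variable {H : Type*} [NormedAddCommGroup H] [InnerProductSpace ℝ H]

open Module.End in
/-- A compact symmetric operator is diagonal in some Hilbert basis. -/
theorem IsCompactOperator.exists_hilbertBasis_eigen.{u} {H : Type u} [NormedAddCommGroup H]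
    [InnerProductSpace ℝ H] [CompleteSpace H] {T : H →L[ℝ] H} (hT : IsCompactOperator T)
    (hT' : T.IsSymmetric) :
    ∃ (κ : Type u) (g : HilbertBasis κ ℝ H) (c : κ → ℝ), ∀ j, T (g j) = c j • g j := by
  have hcl (μ : ℝ) : CompleteSpace (eigenspace (T : Module.End ℝ H) μ) := by
    have : IsClosed (eigenspace (T : Module.End ℝ H) μ : Set H) := by
      have : (eigenspace (T : Module.End ℝ H) μ : Set H) = {x | T x = μ • x} := by
        ext x; simp
      rw [this]
      exact isClosed_eq T.continuous (continuous_const_smul μ)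
    exact this.completeSpace_coe
  choose w b hb using fun μ : ℝ => exists_hilbertBasis ℝ (eigenspace (T : Module.End ℝ H) μ)
  have ho := hT'.orthogonalFamily_eigenspaces.orthonormal_sigma_orthonormal
    (fun μ => (b μ).orthonormal)
  have hbot : (Submodule.span ℝ (Set.range fun j : Σ μ, w μ => (b j.1 j.2 : H)))ᗮ = ⊥ := by
    rw [eq_bot_iff, ← ContinuousLinearMap.orthogonalComplement_iSup_eigenspaces_eq_bot hT hT',
      ← Submodule.iInf_orthogonal]
    intro x hx
    rw [Submodule.mem_iInf]
    intro μ
    rw [Submodule.mem_orthogonal']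
    intro v hv
    have h := ((b μ).hasSum_repr ⟨v, hv⟩).mapL
      ((innerSL ℝ x).comp (eigenspace (T : Module.End ℝ H) μ).subtypeL)
    refine h.unique ?_
    convert hasSum_zero with i
    have : ⟪x, (b μ i : H)⟫ = 0 :=
      (Submodule.mem_orthogonal' _ _).1 hx _ (Submodule.subset_span ⟨⟨μ, i⟩, rfl⟩)
    simp [this]
  let φ : (Σ μ, w μ) ≃ Set.range fun j : Σ μ, w μ => (b j.1 j.2 : H) :=
    Equiv.ofInjective _ ho.linearIndependent.injective
  have hoφ := ho.comp φ.symm φ.symm.injective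
  refine ⟨_, HilbertBasis.mkOfOrthogonalEqBot hoφ ?_, fun j => (φ.symm j).1, fun j => ?_⟩
  · rw [EquivLike.range_comp]
    exact hbot
  · rw [HilbertBasis.coe_mkOfOrthogonalEqBot]
    exact mem_eigenspace_iff.1 (b (φ.symm j).1 (φ.symm j).2).2

/-- If `S` is positive and `S² x = d² x` then `S x = |d| x`. -/
theorem ContinuousLinearMap.IsPositive.apply_eq_abs_smul {S : H →L[ℝ] H} (hS : S.IsPositive)
    {x : H} {d : ℝ} (h : S (S x) = d ^ 2 • x) : S x = |d| • x := by
  have hsymm := hS.isSymmetric.apply_clm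
  rcases eq_or_ne d 0 with rfl | hd
  · have : ⟪S x, S x⟫ = 0 := by rw [hsymm, h]; simp
    simpa using this
  · have hy : S (S x - |d| • x) = -|d| • (S x - |d| • x) := by
      rw [map_sub, map_smul, h, ← sq_abs d]
      module
    have h1 := hS.inner_nonneg_right (S x - |d| • x)
    rw [hy, real_inner_smul_right, real_inner_self_eq_norm_sq] at h1
    have h2 : 0 < |d| := abs_pos.2 hd
    have h3 : ‖S x - |d| • x‖ ^ 2 = 0 := by nlinarith [sq_nonneg ‖S x - |d| • x‖]
    exact sub_eq_zero.1 (by simpa using h3)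

/-- For positive `P`, `Q` and a unit eigenvector `x` of `P - Q` with eigenvalue `t`, the quadratic
form of `P² - Q²` at `x` is at least `t²` in absolute value. -/
theorem ContinuousLinearMap.IsPositive.sq_le_abs_norm_sq_sub {P Q : H →L[ℝ] H}
    (hP : P.IsPositive) (hQ : Q.IsPositive) {x : H} (hx : ‖x‖ = 1) {t : ℝ}
    (ht : (P - Q) x = t • x) : t ^ 2 ≤ |‖P x‖ ^ 2 - ‖Q x‖ ^ 2| := by
  have hPx : P x = Q x + t • x := by rw [← ht]; simp
  have h1 : ‖P x‖ ^ 2 = ‖Q x‖ ^ 2 + 2 * (t * ⟪Q x, x⟫) + t ^ 2 := by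
    rw [hPx, norm_add_sq_real, real_inner_smul_right, norm_smul, hx, mul_one, Real.norm_eq_abs,
      sq_abs]
  have h2 : ⟪P x, x⟫ = ⟪Q x, x⟫ + t := by
    rw [hPx, inner_add_left, real_inner_smul_left, real_inner_self_eq_norm_sq, hx]; ring
  have h3 := hP.inner_nonneg_left x
  have h4 := hQ.inner_nonneg_left x
  rcases le_total 0 t with h | h
  · exact le_trans (by nlinarith) (le_abs_self _)
  · exact le_trans (by nlinarith) (neg_le_abs _)

end

theorem hs_dist_of_sqrt_le_trace_norm
    {H : Type*} [NormedAddCommGroup H] [InnerProductSpace ℝ H] [CompleteSpace H]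
    {ι : Type*} [Countable ι] (e : HilbertBasis ι ℝ H)
    (A B : H →L[ℝ] H)
    (hA : A.IsPositive) (hB : B.IsPositive)
    (hAtr : Summable fun k => ⟪(e k : H), A (e k)⟫)
    (hBtr : Summable fun k => ⟪(e k : H), B (e k)⟫)
    (SA SB : H →L[ℝ] H)
    (hSA : SA.IsPositive ∧ SA ∘L SA = A)
    (hSB : SB.IsPositive ∧ SB ∘L SB = B)
    (S : H →L[ℝ] H)
    (hS : S.IsPositive ∧ S ∘L S = (A - B).adjoint ∘L (A - B)) :
    (∑' k, ‖(SA - SB) (e k)‖ ^ 2) ≤ ∑' k, ⟪(e k : H), S (e k)⟫ := by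
  have hsA := hSA.1.isSymmetric
  have hsB := hSB.1.isSymmetric
  have hA2 (x : H) : ⟪x, A x⟫ = ‖SA x‖ ^ 2 := by
    rw [← hSA.2, ContinuousLinearMap.comp_apply, ← hsA.apply_clm, real_inner_self_eq_norm_sq]
  have hB2 (x : H) : ⟪x, B x⟫ = ‖SB x‖ ^ 2 := by
    rw [← hSB.2, ContinuousLinearMap.comp_apply, ← hsB.apply_clm, real_inner_self_eq_norm_sq]
  simp_rw [hA2] at hAtr
  simp_rw [hB2] at hBtr
  have hcA := e.isCompactOperator_of_summable_norm_sq hsA hAtr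
  have hcB := e.isCompactOperator_of_summable_norm_sq hsB hBtr
  have hDs : (A - B).IsSymmetric := hA.isSymmetric.sub hB.isSymmetric
  have hTs : (SA - SB).IsSymmetric := hsA.sub hsB
  have hDc : IsCompactOperator (A - B) := by
    rw [← hSA.2, ← hSB.2]
    exact (hcA.comp_clm SA).sub (hcB.comp_clm SB)
  have hTc : IsCompactOperator (SA - SB) := hcA.sub hcB
  obtain ⟨κ, g, d, hg⟩ := hDc.exists_hilbertBasis_eigen hDs
  obtain ⟨κ', f, t, hf⟩ := hTc.exists_hilbertBasis_eigen hTs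
  have hD2 (x : H) : ⟪x, (A - B) x⟫ = ‖SA x‖ ^ 2 - ‖SB x‖ ^ 2 := by
    rw [sub_apply, inner_sub_right, hA2, hB2]
  have hSg (j : κ) : S (g j) = |d j| • g j := by
    refine hS.1.apply_eq_abs_smul ?_
    have h := DFunLike.congr_fun hS.2 (g j)
    rw [hDs.isSelfAdjoint.adjoint_eq] at h
    simp only [ContinuousLinearMap.comp_apply] at h
    rw [h, hg, map_smul, hg, smul_smul, sq]
  have hDS (x : H) : |⟪x, (A - B) x⟫| ≤ ⟪x, S x⟫ := by
    have h1 := g.hasSum_inner_apply_of_eigen hDs hg x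
    have h2 := g.hasSum_inner_apply_of_eigen hS.1.isSymmetric hSg x
    rw [abs_le']
    refine ⟨hasSum_le (fun j => ?_) h1 h2, hasSum_le (fun j => ?_) h1.neg h2⟩
    · exact mul_le_mul_of_nonneg_right (le_abs_self _) (sq_nonneg _)
    · rw [← neg_mul]
      exact mul_le_mul_of_nonneg_right (neg_le_abs _) (sq_nonneg _)
  have htrS := e.tsum_inner_apply_eq_of_eigen g hS.1.isSymmetric (fun j => abs_nonneg (d j)) hSg
  have hfin : ∑' k, ENNReal.ofReal ⟪e k, S (e k)⟫ ≠ ⊤ := by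
    have hle (j : κ) : ENNReal.ofReal |d j|
        ≤ ENNReal.ofReal (‖SA (g j)‖ ^ 2) + ENNReal.ofReal (‖SB (g j)‖ ^ 2) := by
      rw [← ENNReal.ofReal_add (sq_nonneg _) (sq_nonneg _)]
      refine ENNReal.ofReal_le_ofReal ?_
      have h := hD2 (g j)
      rw [hg, real_inner_smul_right, real_inner_self_eq_norm_sq, g.orthonormal.1] at h
      rw [abs_le]
      constructor <;> nlinarith [sq_nonneg ‖SA (g j)‖, sq_nonneg ‖SB (g j)‖]
    rw [htrS]
    refine ne_top_of_le_ne_top ?_ (ENNReal.tsum_le_tsum hle)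
    rw [ENNReal.tsum_add, g.tsum_norm_sq_apply_eq e hsA, g.tsum_norm_sq_apply_eq e hsB]
    exact ENNReal.add_ne_top.2 ⟨hAtr.tsum_ofReal_ne_top, hBtr.tsum_ofReal_ne_top⟩
  have hle : ∑' k, ENNReal.ofReal (‖(SA - SB) (e k)‖ ^ 2)
      ≤ ∑' k, ENNReal.ofReal ⟪e k, S (e k)⟫ := by
    rw [e.tsum_norm_sq_apply_eq f hTs, htrS,
      ← f.tsum_inner_apply_eq_of_eigen g hS.1.isSymmetric (fun j => abs_nonneg (d j)) hSg]
    refine ENNReal.tsum_le_tsum fun i => ENNReal.ofReal_le_ofReal ?_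
    have hfi : ‖f i‖ = 1 := f.orthonormal.1 i
    rw [hf, norm_smul, hfi, mul_one, Real.norm_eq_abs, sq_abs]
    refine (hSA.1.sq_le_abs_norm_sq_sub hSB.1 hfi (hf i)).trans ?_
    rw [← hD2]
    exact hDS _
  have h := ENNReal.toReal_mono hfin hle
  rw [ENNReal.tsum_toReal_eq fun _ => ENNReal.ofReal_ne_top,
    ENNReal.tsum_toReal_eq fun _ => ENNReal.ofReal_ne_top] at h
  simpa only [ENNReal.toReal_ofReal (sq_nonneg _),
    ENNReal.toReal_ofReal (hS.1.inner_nonneg_right _)] using h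

end
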